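/- arXiv:2211.12381 — 2 statements merged into one kernel-verified Lean document; each statement's English description precedes it below -/
import Mathlib

section
/- The Frobenius endomorphism a ↦ a^p of the ring F_p[y^{1/p^∞}]/(y) is surjective but not injective; in particular F_p[y^{1/p^∞}]/(y) is a semiperfect F_p-algebra which is not perfect. -/
/-- The additive monoid `M = ℤ[1/p]_{≥ 0}` of nonnegative rational numbers whose
denominator is a power of `p`, realized as an additive submonoid of `ℚ`. -/
def Mp (p : ℕ) : AddSubmonoid ℚ where
  carrier := {q | 0 ≤ q ∧ ∃ (k : ℕ) (m : ℤ), q * (p : ℚ) ^ k = m}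
  zero_mem' := ⟨le_refl 0, 0, 0, by norm_num⟩
  add_mem' := by
    rintro a b ⟨ha, k, m, hm⟩ ⟨hb, l, n, hn⟩
    refine ⟨add_nonneg ha hb, k + l, m * (p : ℤ) ^ l + n * (p : ℤ) ^ k, ?_⟩
    push_cast
    calc (a + b) * (p : ℚ) ^ (k + l)
        = (a * (p : ℚ) ^ k) * (p : ℚ) ^ l + (b * (p : ℚ) ^ l) * (p : ℚ) ^ k := by
          rw [pow_add]; ring
      _ = (m : ℚ) * (p : ℚ) ^ l + (n : ℚ) * (p : ℚ) ^ k := by rw [hm, hn]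

/-- `F_p[y^{1/p^∞}]`, the monoid algebra of `M` over `F_p = ZMod p`. -/
abbrev Rp (p : ℕ) : Type := AddMonoidAlgebra (ZMod p) (Mp p)

/-- The basis element `y^q` of `F_p[y^{1/p^∞}]`, for `q ∈ M`. -/
noncomputable def ye (p : ℕ) (q : Mp p) : Rp p := AddMonoidAlgebra.single q 1

/-- `1 ∈ M`. -/
def oneM (p : ℕ) : Mp p := ⟨1, zero_le_one, 0, 1, by norm_num⟩

/-- The quotient ring `F_p[y^{1/p^∞}]/(y)`. -/
abbrev Ap (p : ℕ) : Type := Rp p ⧸ Ideal.span {ye p (oneM p)}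

theorem mem_div_p (p : ℕ) (hp : p.Prime) (q : ℚ) (hq : q ∈ Mp p) : q / p ∈ Mp p := by
  obtain ⟨h0, k, m, hm⟩ := hq
  have hp0 : (p : ℚ) ≠ 0 := by exact_mod_cast hp.ne_zero
  refine ⟨by positivity, k + 1, m, ?_⟩
  rw [← hm, pow_succ]
  field_simp

/-- division by p -/
def divM (p : ℕ) (hp : p.Prime) (q : Mp p) : Mp p := ⟨(q : ℚ) / p, mem_div_p p hp q q.2⟩

theorem smul_divM (p : ℕ) (hp : p.Prime) (q : Mp p) : p • divM p hp q = q := by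
  have hp0 : (p : ℚ) ≠ 0 := by exact_mod_cast hp.ne_zero
  apply Subtype.ext
  simp only [divM, AddSubmonoidClass.coe_nsmul, nsmul_eq_mul]
  field_simp

theorem Rp_surj (p : ℕ) (hp : p.Prime) (x : Rp p) : ∃ b : Rp p, b ^ p = x := by
  have : Fact p.Prime := ⟨hp⟩
  have : CharP (Rp p) p := charP_of_injective_algebraMap (algebraMap (ZMod p) (Rp p)).injective p
  induction x using AddMonoidAlgebra.induction_linear with
  | zero => exact ⟨0, zero_pow hp.ne_zero⟩
  | add f g hf hg =>
    obtain ⟨a, rfl⟩ := hf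
    obtain ⟨b, rfl⟩ := hg
    exact ⟨a + b, add_pow_char _ _ _⟩
  | single q c =>
    refine ⟨AddMonoidAlgebra.single (divM p hp q) c, ?_⟩
    rw [AddMonoidAlgebra.single_pow, smul_divM, ZMod.pow_card]

theorem root_notMem (p : ℕ) (hp : p.Prime) :
    ye p (divM p hp (oneM p)) ∉ Ideal.span {ye p (oneM p)} := by
  have : Fact p.Prime := ⟨hp⟩
  rw [Ideal.mem_span_singleton']
  rintro ⟨f, hf⟩
  have h := congrArg (fun g : Rp p => g.coeff (divM p hp (oneM p))) hf
  simp only [ye] at h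
  rw [AddMonoidAlgebra.coeff_mul_single_of_forall_add_ne] at h
  · simp at h
  · rintro d hd
    have h1 := congrArg (fun z : Mp p => (z : ℚ)) hd
    simp only [divM, oneM, AddSubmonoid.coe_add] at h1
    have h2 : (0 : ℚ) ≤ d := d.2.1
    have h3 : (1 : ℚ) < p := by exact_mod_cast hp.one_lt
    have h4 : (1 : ℚ) / p < 1 := by rw [div_lt_one (by linarith)]; exact h3
    linarith

/-- the Frobenius endomorphism `a ↦ a ^ p` of `F_p[y^{1/p^∞}]/(y)`
is surjective but not injective: the ring is semiperfect but not perfect. -/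
theorem statement2 (p : ℕ) (hp : p.Prime) :
    Function.Surjective (fun a : Ap p => a ^ p) ∧
      ¬ Function.Injective (fun a : Ap p => a ^ p) := by
  constructor
  · intro a
    obtain ⟨x, rfl⟩ := Ideal.Quotient.mk_surjective a
    obtain ⟨b, rfl⟩ := Rp_surj p hp x
    exact ⟨Ideal.Quotient.mk _ b, by simp⟩
  · intro hinj
    apply root_notMem p hp
    rw [← Ideal.Quotient.eq_zero_iff_mem]
    apply hinj
    simp only
    rw [zero_pow hp.ne_zero, ← map_pow, Ideal.Quotient.eq_zero_iff_mem]
    have : ye p (divM p hp (oneM p)) ^ p = ye p (oneM p) := by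
      simp only [ye]
      rw [AddMonoidAlgebra.single_pow, smul_divM, one_pow]
    rw [this]
    exact Ideal.mem_span_singleton_self _
end

section
/- Let R be a commutative F_p-algebra (characteristic p) whose Frobenius endomorphism is bijective (i.e. R is perfect), and let S be an étale R-algebra. Then the Frobenius endomorphism of S is bijective, i.e. S is perfect. -/
open TensorProduct in
theorem aux_bot {A : Type*} [CommRing A] (I : Ideal A) (hfg : I.FG) (hI : IsIdempotentElem I)
    (hn : I ≤ nilradical A) : I = ⊥ := by
  obtain ⟨e, he, rfl⟩ := (Ideal.isIdempotentElem_iff_of_fg I hfg).mp hI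
  obtain ⟨n, h⟩ := hn (Ideal.mem_span_singleton_self e)
  have : e = 0 := by
    rcases Nat.eq_zero_or_pos n with rfl | hpos
    · have h1 : (1 : A) = 0 := by simpa using h
      calc e = e * 1 := by simp
        _ = 0 := by rw [h1, mul_zero]
    · rw [← he.pow_eq hpos.ne', h]
  simp [this]

open TensorProduct in
theorem aux_bij (p : ℕ) [Fact p.Prime] {A B : Type*} [CommRing A] [CommRing B] [CharP A p]
    [Algebra A B] [Algebra.Etale A B] (h1 : ∀ b : B, ∃ a, algebraMap A B a = b ^ p)
    (h2 : ∀ a, algebraMap A B a = 0 → IsNilpotent a) :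
    Function.Bijective (algebraMap A B) := by
  have hp : p.Prime := Fact.out
  have hz : ((p : ℕ) : B ⊗[A] B) = 0 := by
    rw [← map_natCast (algebraMap A (B ⊗[A] B)), CharP.cast_eq_zero, map_zero]
  have hI : KaehlerDifferential.ideal A B = ⊥ := by
    apply aux_bot _ (KaehlerDifferential.ideal_fg A B)
    · rw [← Ideal.cotangent_subsingleton_iff]
      exact (Algebra.formallyUnramified_iff A B).mp inferInstance
    · rw [← KaehlerDifferential.span_range_eq_ideal, Ideal.span_le]
      rintro _ ⟨s, rfl⟩
      refine ⟨p, ?_⟩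
      obtain ⟨a, ha⟩ := h1 s
      rcases subsingleton_or_nontrivial (B ⊗[A] B) with h | h
      · exact Subsingleton.elim _ _
      have : CharP (B ⊗[A] B) p := (CharP.charP_iff_prime_eq_zero hp).mpr hz
      simp only
      rw [sub_pow_char, Algebra.TensorProduct.tmul_pow, Algebra.TensorProduct.tmul_pow, ← ha]
      rw [one_pow, Algebra.algebraMap_eq_smul_one, TensorProduct.tmul_smul,
        TensorProduct.smul_tmul', sub_self]
      exact Ideal.zero_mem _
  have hepi : Algebra.IsEpi A B := by
    rw [Algebra.isEpi_iff_forall_one_tmul_eq]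
    intro b
    have : (1 ⊗ₜ[A] b - b ⊗ₜ[A] 1 : B ⊗[A] B) ∈ KaehlerDifferential.ideal A B :=
      KaehlerDifferential.one_smul_sub_smul_one_mem_ideal A b
    rw [hI] at this
    exact sub_eq_zero.mp this
  have : Algebra.IsIntegral A B := ⟨fun b => by
    obtain ⟨a, ha⟩ := h1 b
    refine IsIntegral.of_pow hp.pos (?_ : IsIntegral A (b ^ p))
    rw [← ha]; exact isIntegral_algebraMap⟩
  have : Module.Finite A B := Algebra.IsIntegral.finite
  have hs := Algebra.isEpi_iff_surjective_algebraMap_of_finite.mp hepi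
  refine ⟨?_, hs⟩
  rw [RingHom.injective_iff_ker_eq_bot]
  refine aux_bot _ ?_ ((Algebra.FormallyEtale.iff_of_surjective hs).mp inferInstance) ?_
  · exact Algebra.FinitePresentation.ker_fG_of_surjective (Algebra.ofId A B) hs
  · intro a ha
    exact h2 a ha

/-- if `R` is a commutative `F_p`-algebra whose Frobenius `a ↦ a^p` is
bijective (i.e. `R` is perfect) and `S` is an étale `R`-algebra, then the Frobenius
endomorphism of `S` is bijective, i.e. `S` is perfect. -/
theorem statement13 (p : ℕ) (hp : p.Prime) (R S : Type) [CommRing R] [CommRing S]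
    [Algebra (ZMod p) R] [Algebra R S] [Algebra.Etale R S]
    (hR : Function.Bijective fun a : R => a ^ p) :
    Function.Bijective fun a : S => a ^ p := by
  have : Fact p.Prime := ⟨hp⟩
  rcases subsingleton_or_nontrivial S with h | h
  · exact ⟨fun _ _ _ => Subsingleton.elim _ _, fun b => ⟨b, Subsingleton.elim _ _⟩⟩
  have hzR : ((p : ℕ) : R) = 0 := by
    rw [← map_natCast (algebraMap (ZMod p) R), CharP.cast_eq_zero, map_zero]
  have hzS : ((p : ℕ) : S) = 0 := by
    rw [← map_natCast (algebraMap R S), hzR, map_zero]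
  have : Nontrivial R := (algebraMap R S).domain_nontrivial
  have : CharP R p := (CharP.charP_iff_prime_eq_zero hp).mpr hzR
  have : CharP S p := (CharP.charP_iff_prime_eq_zero hp).mpr hzS
  have hf : (algebraMap R S).Etale := RingHom.etale_algebraMap.mpr inferInstance
  have hφ : (frobenius R p).Etale := .of_bijective hR
  have hc : ((algebraMap R S).comp (frobenius R p)).Etale :=
    RingHom.Etale.stableUnderComposition _ _ hφ hf
  have hE : (frobenius S p).Etale := by
    refine @Algebra.Etale.of_restrictScalars R S S _ _ _ _
      ((algebraMap R S).comp (frobenius R p)).toAlgebra (frobenius S p).toAlgebra ?_ _ hc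
    refine @IsScalarTower.of_algebraMap_eq R S S _ _ _ _ (frobenius S p).toAlgebra
      ((algebraMap R S).comp (frobenius R p)).toAlgebra ?_
    intro x
    change algebraMap R S (x ^ p) = (algebraMap R S x) ^ p
    simp
  exact @aux_bij p _ S S _ _ _ (frobenius S p).toAlgebra hE (fun b => ⟨b, rfl⟩)
    (fun a ha => ⟨p, ha⟩)
end
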